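/- arXiv:1904.06801 — 4 statements merged into one kernel-verified Lean document; each statement's English description precedes it below -/
import Mathlib

section
/- Let n ≥ 3 and 0 < δ < n−2. There is a constant c > 0 depending only on n and δ such that for every continuous f : ℝⁿ → ℝ with |f(y)| ≤ M (1+|y|²)^{−(δ+2)/2} for all y ∈ ℝⁿ, the Newton potential satisfies |(Φf)(x)| ≤ c M (1+|x|²)^{−δ/2} for all x ∈ ℝⁿ. -/
open MeasureTheory

/-- The surface area `σ_n` of the unit sphere in `ℝⁿ` (equal to `n` times the volume of the
unit ball). -/
noncomputable def sphereArea (n : ℕ) : ℝ :=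
  (n : ℝ) * (volume (Metric.ball (0 : EuclideanSpace ℝ (Fin n)) 1)).toReal

/-- The Newton potential `(Φf)(x) = (σ_n(2−n))^{−1} ∫ |x−y|^{2−n} f(y) dy` on `ℝⁿ`, `n ≥ 3`. -/
noncomputable def newton (n : ℕ) (f : EuclideanSpace ℝ (Fin n) → ℝ)
    (x : EuclideanSpace ℝ (Fin n)) : ℝ :=
  (sphereArea n * (2 - (n : ℝ)))⁻¹ *
    ∫ y : EuclideanSpace ℝ (Fin n), ‖x - y‖ ^ ((2 : ℝ) - n) * f y

lemma sqrt_one_add_norm_sq_le_add_norm_sub {E : Type*} [NormedAddCommGroup E] (x y : E) :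
    √(1 + ‖x‖ ^ 2) ≤ √(1 + ‖y‖ ^ 2) + ‖x - y‖ := by
  have hxy : ‖x‖ ≤ ‖y‖ + ‖x - y‖ := by simpa using norm_add_le y (x - y)
  have hb : ‖y‖ ≤ √(1 + ‖y‖ ^ 2) := Real.le_sqrt_of_sq_le (by linarith)
  have hb2 : √(1 + ‖y‖ ^ 2) ^ 2 = 1 + ‖y‖ ^ 2 := Real.sq_sqrt (by positivity)
  refine Real.sqrt_le_iff.2 ⟨by positivity, ?_⟩
  nlinarith [norm_nonneg x, norm_nonneg y, norm_nonneg (x - y),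
    mul_le_mul_of_nonneg_right hb (norm_nonneg (x - y)), pow_le_pow_left₀ (norm_nonneg x) hxy 2]

lemma norm_sub_rpow_mul_sqrt_rpow_le {E : Type*} [NormedAddCommGroup E] [NormedSpace ℝ E]
    {p s : ℝ} (hp : 0 ≤ p) (hs : 0 ≤ s) (x : E) {y : E}
    (hy : y ≠ 0) {a : ℝ} (ha : a = √(1 + ‖x‖ ^ 2)) :
    ‖x - y‖ ^ (-p) * √(1 + ‖y‖ ^ 2) ^ (-s) ≤ a ^ (-(p + s)) *
      (2 ^ s * (Metric.ball (0 : E) 1).indicator (fun z ↦ ‖z‖ ^ (-p)) (a⁻¹ • (x - y)) +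
        5 ^ p * ((1 + ‖a⁻¹ • y‖) ^ (-p) * ‖a⁻¹ • y‖ ^ (-s))) := by
  have hab := sqrt_one_add_norm_sq_le_add_norm_sub x y
  have ha1 : ‖x‖ ≤ a := ha ▸ Real.le_sqrt_of_sq_le (by linarith)
  have hb : ‖y‖ ≤ √(1 + ‖y‖ ^ 2) := Real.le_sqrt_of_sq_le (by linarith)
  have ha0 : 0 < a := ha ▸ by positivity
  rw [← ha] at hab
  have hy0 : 0 < ‖y‖ := norm_pos_iff.2 hy
  have hyx : ‖y‖ ≤ a + ‖x - y‖ := by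
    linarith [norm_sub_norm_le y x, norm_sub_rev x y]
  have hn (v : E) : ‖a⁻¹ • v‖ = ‖v‖ / a := by
    rw [norm_smul, norm_inv, Real.norm_of_nonneg ha0.le]; field_simp
  have hind : 0 ≤ (Metric.ball (0 : E) 1).indicator (fun z ↦ ‖z‖ ^ (-p)) (a⁻¹ • (x - y)) :=
    Set.indicator_nonneg (fun _ _ ↦ by positivity) _
  rcases lt_or_ge ‖x - y‖ (a / 2) with h | h
  · have hmem : a⁻¹ • (x - y) ∈ Metric.ball (0 : E) 1 := by
      rw [mem_ball_zero_iff, hn, div_lt_one ha0]; linarith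
    rw [Set.indicator_of_mem hmem]
    calc ‖x - y‖ ^ (-p) * √(1 + ‖y‖ ^ 2) ^ (-s) ≤ ‖x - y‖ ^ (-p) * (a / 2) ^ (-s) := by
          gcongr ?_ * ?_
          exact Real.rpow_le_rpow_of_nonpos (by linarith) (by linarith) (by linarith)
      _ = a ^ (-(p + s)) * (2 ^ s * ‖a⁻¹ • (x - y)‖ ^ (-p)) := by
          rw [hn, Real.div_rpow ha0.le zero_le_two, Real.rpow_neg zero_le_two s,
            Real.div_rpow (norm_nonneg _) ha0.le, neg_add, Real.rpow_add ha0]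
          field_simp
      _ ≤ _ := by
          gcongr
          exact le_add_of_nonneg_right (by positivity)
  · calc ‖x - y‖ ^ (-p) * √(1 + ‖y‖ ^ 2) ^ (-s)
        ≤ ((a + ‖y‖) / 5) ^ (-p) * ‖y‖ ^ (-s) := by
          gcongr ?_ * ?_
          · exact Real.rpow_le_rpow_of_nonpos (by positivity) (by linarith) (by linarith)
          · exact Real.rpow_le_rpow_of_nonpos hy0 hb (by linarith)
      _ = a ^ (-(p + s)) * (5 ^ p * ((1 + ‖a⁻¹ • y‖) ^ (-p) * ‖a⁻¹ • y‖ ^ (-s))) := by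
          have h1 : 1 + ‖y‖ / a = (a + ‖y‖) / a := by field_simp
          have h2 : 0 < a + ‖y‖ := by positivity
          rw [hn, h1, Real.div_rpow h2.le (by norm_num : (0 : ℝ) ≤ 5),
            Real.rpow_neg (by norm_num : (0 : ℝ) ≤ 5) p, Real.div_rpow h2.le ha0.le,
            Real.div_rpow hy0.le ha0.le, neg_add, Real.rpow_add ha0]
          field_simp
      _ ≤ _ := by
          gcongr
          exact le_add_of_nonneg_left (by positivity)

section RieszKernel

variable {E : Type*} [NormedAddCommGroup E] [NormedSpace ℝ E] [FiniteDimensional ℝ E]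
  [MeasurableSpace E] [BorelSpace E] {μ : Measure E} [μ.IsAddHaarMeasure]

lemma integrable_indicator_ball_norm_rpow_neg (hd : 1 ≤ Module.finrank ℝ E) {p : ℝ}
    (hp : p < Module.finrank ℝ E) :
    Integrable ((Metric.ball (0 : E) 1).indicator fun z ↦ ‖z‖ ^ (-p)) μ := by
  rw [integrable_indicator_iff measurableSet_ball]
  refine integrableOn_ball_of_norm_le_rpow hd (C := 1) hp (.of_forall fun z ↦ ?_)
    (by fun_prop : Measurable fun z : E ↦ ‖z‖ ^ (-p)).aestronglyMeasurable
  rw [one_mul, Real.norm_of_nonneg (by positivity)]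

lemma integrable_one_add_norm_rpow_mul_norm_rpow (hd : 1 ≤ Module.finrank ℝ E) {p s : ℝ}
    (hs0 : 0 ≤ s) (hs : s < Module.finrank ℝ E) (hps : Module.finrank ℝ E < p + s) :
    Integrable (fun z : E ↦ (1 + ‖z‖) ^ (-p) * ‖z‖ ^ (-s)) μ := by
  have hmeas : AEStronglyMeasurable (fun z : E ↦ (1 + ‖z‖) ^ (-p) * ‖z‖ ^ (-s)) μ :=
    (by fun_prop : Measurable fun z : E ↦ (1 + ‖z‖) ^ (-p) * ‖z‖ ^ (-s)).aestronglyMeasurable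
  rw [← integrableOn_univ, ← Set.union_compl_self (Metric.ball (0 : E) 1), integrableOn_union]
  constructor
  · refine integrableOn_ball_of_norm_le_rpow hd (C := 1) hs (.of_forall fun z ↦ ?_) hmeas
    rw [Real.norm_of_nonneg (by positivity)]
    gcongr
    exact Real.rpow_le_one_of_one_le_of_nonpos (by linarith [norm_nonneg z]) (by linarith)
  · refine Integrable.mono' ((integrable_one_add_norm hps).const_mul (2 ^ s)).integrableOn
      hmeas.restrict ?_
    filter_upwards [ae_restrict_mem measurableSet_ball.compl] with z hz
    have hz1 : 1 ≤ ‖z‖ := by simpa using hz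
    have h0 : 0 < 1 + ‖z‖ := by linarith
    rw [Real.norm_of_nonneg (by positivity)]
    calc (1 + ‖z‖) ^ (-p) * ‖z‖ ^ (-s)
        ≤ (1 + ‖z‖) ^ (-p) * ((1 + ‖z‖) / 2) ^ (-s) := by
          gcongr ?_ * ?_
          exact Real.rpow_le_rpow_of_nonpos (by linarith) (by linarith) (by linarith)
      _ = 2 ^ s * (1 + ‖z‖) ^ (-(p + s)) := by
          rw [Real.div_rpow h0.le zero_le_two, Real.rpow_neg zero_le_two s, neg_add,
            Real.rpow_add h0]
          field_simp

/-- Decay of the Riesz potential of order `d - p` of the weight `(1 + |y|²)^(-s/2)`. -/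
lemma exists_integral_norm_sub_rpow_mul_le (hd : 1 ≤ Module.finrank ℝ E) {p s : ℝ}
    (hp0 : 0 ≤ p) (hp : p < Module.finrank ℝ E) (hs0 : 0 ≤ s) (hs : s < Module.finrank ℝ E)
    (hps : Module.finrank ℝ E < p + s) :
    ∃ C : ℝ, 0 ≤ C ∧ ∀ x : E,
      Integrable (fun y ↦ ‖x - y‖ ^ (-p) * √(1 + ‖y‖ ^ 2) ^ (-s)) μ ∧
      ∫ y, ‖x - y‖ ^ (-p) * √(1 + ‖y‖ ^ 2) ^ (-s) ∂μ ≤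
        C * √(1 + ‖x‖ ^ 2) ^ (Module.finrank ℝ E - (p + s)) := by
  have : Nontrivial E := Module.nontrivial_of_finrank_pos (R := ℝ) hd
  set h₁ : E → ℝ := (Metric.ball (0 : E) 1).indicator fun z ↦ ‖z‖ ^ (-p) with hh₁
  set h₂ : E → ℝ := fun z ↦ (1 + ‖z‖) ^ (-p) * ‖z‖ ^ (-s) with hh₂
  have i₁ : Integrable h₁ μ := integrable_indicator_ball_norm_rpow_neg hd hp
  have i₂ : Integrable h₂ μ := integrable_one_add_norm_rpow_mul_norm_rpow hd hs0 hs hps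
  have n₁ : 0 ≤ ∫ z, h₁ z ∂μ :=
    integral_nonneg fun z ↦ Set.indicator_nonneg (fun _ _ ↦ by positivity) _
  have n₂ : 0 ≤ ∫ z, h₂ z ∂μ := integral_nonneg fun z ↦ by simp only [hh₂]; positivity
  refine ⟨2 ^ s * ∫ z, h₁ z ∂μ + 5 ^ p * ∫ z, h₂ z ∂μ, by positivity, fun x ↦ ?_⟩
  obtain ⟨a, ha⟩ : ∃ a, a = √(1 + ‖x‖ ^ 2) := ⟨_, rfl⟩
  have ha0 : 0 < a := ha ▸ by positivity
  have j₁ : Integrable (fun y ↦ 2 ^ s * h₁ (a⁻¹ • (x - y))) μ :=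
    ((i₁.comp_smul (inv_ne_zero ha0.ne')).comp_sub_left x).const_mul _
  have j₂ : Integrable (fun y ↦ 5 ^ p * h₂ (a⁻¹ • y)) μ :=
    (i₂.comp_smul (inv_ne_zero ha0.ne')).const_mul _
  have hle : ∀ᵐ y ∂μ, ‖x - y‖ ^ (-p) * √(1 + ‖y‖ ^ 2) ^ (-s) ≤ a ^ (-(p + s)) *
      (2 ^ s * h₁ (a⁻¹ • (x - y)) + 5 ^ p * h₂ (a⁻¹ • y)) := by
    filter_upwards [Measure.ae_ne μ 0] with y hy
    exact norm_sub_rpow_mul_sqrt_rpow_le hp0 hs0 x hy ha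
  have hint : Integrable (fun y ↦ ‖x - y‖ ^ (-p) * √(1 + ‖y‖ ^ 2) ^ (-s)) μ := by
    refine ((j₁.add j₂).const_mul (a ^ (-(p + s)))).mono' (by fun_prop : Measurable fun y : E ↦
      ‖x - y‖ ^ (-p) * √(1 + ‖y‖ ^ 2) ^ (-s)).aestronglyMeasurable ?_
    filter_upwards [hle] with y hy
    rwa [Real.norm_of_nonneg (by positivity)]
  refine ⟨hint, (integral_mono_ae hint ((j₁.add j₂).const_mul _) hle).trans_eq ?_⟩
  simp only [Pi.add_apply]
  rw [integral_const_mul, integral_add j₁ j₂, integral_const_mul, integral_const_mul,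
    integral_sub_left_eq_self (fun y ↦ h₁ (a⁻¹ • y)) μ x,
    Measure.integral_comp_inv_smul_of_nonneg μ h₁ ha0.le,
    Measure.integral_comp_inv_smul_of_nonneg μ h₂ ha0.le, ← ha, sub_eq_add_neg,
    Real.rpow_add ha0, Real.rpow_natCast, smul_eq_mul, smul_eq_mul]
  ring

end RieszKernel

/-- for `n ≥ 3` and `0 < δ < n−2` there is `c > 0` depending only on `n` and `δ`
such that for every continuous `f` with `|f(y)| ≤ M(1+|y|²)^{−(δ+2)/2}`, the Newton potential
satisfies `|(Φf)(x)| ≤ c M (1+|x|²)^{−δ/2}` for all `x`. -/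
theorem statement10 (n : ℕ) (hn : 3 ≤ n) (δ : ℝ) (hδ0 : 0 < δ) (hδ1 : δ < (n : ℝ) - 2) :
    ∃ c : ℝ, 0 < c ∧
      ∀ (f : EuclideanSpace ℝ (Fin n) → ℝ) (M : ℝ), Continuous f →
        (∀ y, |f y| ≤ M * (1 + ‖y‖ ^ 2) ^ (-(δ + 2) / 2)) →
        ∀ x : EuclideanSpace ℝ (Fin n),
          |newton n f x| ≤ c * M * (1 + ‖x‖ ^ 2) ^ (-δ / 2) := by
  have hd : Module.finrank ℝ (EuclideanSpace ℝ (Fin n)) = n := by simp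
  have hn' : (3 : ℝ) ≤ n := by exact_mod_cast hn
  obtain ⟨C, hC, hbound⟩ := exists_integral_norm_sub_rpow_mul_le
    (E := EuclideanSpace ℝ (Fin n)) (μ := volume) (p := n - 2) (s := δ + 2) (by omega)
    (by linarith) (by rw [hd]; linarith) (by linarith) (by rw [hd]; linarith)
    (by rw [hd]; linarith)
  have hsqrt (t : ℝ) (x : EuclideanSpace ℝ (Fin n)) :
      (1 + ‖x‖ ^ 2) ^ (-t / 2) = √(1 + ‖x‖ ^ 2) ^ (-t) := by
    rw [Real.sqrt_eq_rpow, ← Real.rpow_mul (by positivity)]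
    congr 1
    ring
  set K := |(sphereArea n * (2 - (n : ℝ)))⁻¹| with hK
  have hK0 : 0 ≤ K := abs_nonneg _
  refine ⟨K * C + 1, by positivity, fun f M _ hf x ↦ ?_⟩
  have hM : 0 ≤ M := by simpa using (abs_nonneg _).trans (hf 0)
  obtain ⟨hint, hle⟩ := hbound x
  have hδ : (Module.finrank ℝ (EuclideanSpace ℝ (Fin n)) : ℝ) - (n - 2 + (δ + 2)) = -δ := by
    rw [hd]; ring
  rw [hδ] at hle
  have hI : |∫ y, ‖x - y‖ ^ ((2 : ℝ) - n) * f y| ≤ M * (C * √(1 + ‖x‖ ^ 2) ^ (-δ)) := by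
    rw [← Real.norm_eq_abs]
    refine (norm_integral_le_of_norm_le (hint.const_mul M) (.of_forall fun y ↦ ?_)).trans ?_
    · rw [norm_mul, Real.norm_of_nonneg (by positivity), Real.norm_eq_abs, ← hsqrt, neg_sub,
        mul_left_comm]
      gcongr
      exact hf y
    · rw [integral_const_mul]
      gcongr
  rw [newton, abs_mul, ← hK, hsqrt]
  calc K * |∫ y, ‖x - y‖ ^ ((2 : ℝ) - n) * f y|
      ≤ K * (M * (C * √(1 + ‖x‖ ^ 2) ^ (-δ))) := by gcongr
    _ ≤ K * (M * (C * √(1 + ‖x‖ ^ 2) ^ (-δ))) + M * √(1 + ‖x‖ ^ 2) ^ (-δ) :=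
        le_add_of_nonneg_right (by positivity)
    _ = (K * C + 1) * M * √(1 + ‖x‖ ^ 2) ^ (-δ) := by ring
end

section
/- Let n ≥ 1, δ > 0, γ > 0, μ > 0 and T > 0. There exists a constant c > 0 depending only on n, δ, γ, μ and T such that for all x ∈ ℝⁿ and all t ∈ (0,T]: ∫_{ℝⁿ} (1 + |x−y|²/(4μt))^γ ψ_μ(x−y, t) (1+|y|²)^{−δ/2} dy ≤ c (1+|x|²)^{−δ/2}. -/
open MeasureTheory

/-- The standard heat kernel `ψ_μ(x,t) = (4πμt)^{−n/2} exp(−|x|²/(4μt))` on `ℝⁿ` (for `t > 0`). -/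
noncomputable def heatK (n : ℕ) (μ : ℝ) (x : EuclideanSpace ℝ (Fin n)) (t : ℝ) : ℝ :=
  (4 * Real.pi * μ * t) ^ (-(n : ℝ) / 2) * Real.exp (-‖x‖ ^ 2 / (4 * μ * t))

/-- Peetre's inequality for the Japanese bracket. -/
theorem one_add_norm_sq_le_two_mul {E : Type*} [SeminormedAddCommGroup E] (x y : E) :
    1 + ‖x‖ ^ 2 ≤ 2 * (1 + ‖x - y‖ ^ 2) * (1 + ‖y‖ ^ 2) := by
  have h : ‖x‖ ≤ ‖x - y‖ + ‖y‖ := by simpa using norm_add_le (x - y) y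
  have h2 : ‖x‖ ^ 2 ≤ (‖x - y‖ + ‖y‖) ^ 2 := by gcongr
  nlinarith [sq_nonneg (‖x - y‖ - ‖y‖), mul_nonneg (sq_nonneg ‖x - y‖) (sq_nonneg ‖y‖)]

/-- A power is dominated by the exponential, with an explicit constant. -/
theorem one_add_rpow_le_exp_half {a r : ℝ} (ha : 0 < a) (hr : 0 ≤ r) :
    (1 + r) ^ a ≤ (2 * a) ^ a * Real.exp (1 / 2) * Real.exp (r / 2) := by
  have h : 1 + r ≤ 2 * a * Real.exp ((1 + r) / (2 * a)) := by
    have h1 : (1 + r) / (2 * a) ≤ Real.exp ((1 + r) / (2 * a)) := by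
      linarith [Real.add_one_le_exp ((1 + r) / (2 * a))]
    rwa [div_le_iff₀' (by positivity)] at h1
  calc (1 + r) ^ a ≤ (2 * a * Real.exp ((1 + r) / (2 * a))) ^ a := by gcongr
    _ = (2 * a) ^ a * Real.exp (1 / 2) * Real.exp (r / 2) := by
      rw [Real.mul_rpow (by positivity) (by positivity), ← Real.exp_mul, mul_assoc, ← Real.exp_add]
      congr 2
      field_simp

/-- Peetre's inequality raised to a negative power, with the difference `x - y` measured at
the parabolic scale `√s`, uniformly for `s` in a bounded interval. -/
theorem one_add_norm_sq_rpow_neg_le {E : Type*} [SeminormedAddCommGroup E] {p s S : ℝ}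
    (hp : 0 ≤ p) (hs : 0 < s) (hsS : s ≤ S) (x y : E) :
    (1 + ‖y‖ ^ 2) ^ (-p) ≤
      (2 * (1 + S)) ^ p * (1 + ‖x - y‖ ^ 2 / s) ^ p * (1 + ‖x‖ ^ 2) ^ (-p) := by
  have hS : 0 < S := hs.trans_le hsS
  have hr : 0 ≤ ‖x - y‖ ^ 2 / s := by positivity
  have h1 : 1 + ‖x - y‖ ^ 2 ≤ (1 + S) * (1 + ‖x - y‖ ^ 2 / s) := by
    have h2 : ‖x - y‖ ^ 2 = s * (‖x - y‖ ^ 2 / s) := by field_simp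
    have h3 : s * (‖x - y‖ ^ 2 / s) ≤ S * (‖x - y‖ ^ 2 / s) := by gcongr
    linarith
  have h4 : 1 + ‖x‖ ^ 2 ≤ 2 * (1 + S) * (1 + ‖x - y‖ ^ 2 / s) * (1 + ‖y‖ ^ 2) :=
    calc 1 + ‖x‖ ^ 2 ≤ 2 * (1 + ‖x - y‖ ^ 2) * (1 + ‖y‖ ^ 2) := one_add_norm_sq_le_two_mul x y
      _ ≤ 2 * ((1 + S) * (1 + ‖x - y‖ ^ 2 / s)) * (1 + ‖y‖ ^ 2) := by gcongr
      _ = _ := by ring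
  have h5 := Real.rpow_le_rpow (by positivity) h4 hp
  rw [Real.mul_rpow (by positivity) (by positivity),
    Real.mul_rpow (by positivity) (by positivity)] at h5
  rw [Real.rpow_neg (by positivity), Real.rpow_neg (by positivity), ← div_eq_mul_inv,
    inv_eq_one_div, div_le_div_iff₀ (by positivity) (by positivity), one_mul]
  exact h5

/-- A Gaussian on Euclidean space, translated and reflected, is integrable, with the usual
integral. -/
theorem integrable_and_integral_exp_neg_norm_sub_sq {n : ℕ} {b : ℝ} (hb : 0 < b)
    (x : EuclideanSpace ℝ (Fin n)) :
    Integrable (fun y : EuclideanSpace ℝ (Fin n) ↦ Real.exp (-b * ‖x - y‖ ^ 2)) ∧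
      ∫ y : EuclideanSpace ℝ (Fin n), Real.exp (-b * ‖x - y‖ ^ 2) =
        (Real.pi / b) ^ ((n : ℝ) / 2) := by
  have h : ∫ y : EuclideanSpace ℝ (Fin n), Real.exp (-b * ‖x - y‖ ^ 2) =
      (Real.pi / b) ^ ((n : ℝ) / 2) := by
    rw [integral_sub_left_eq_self (fun z : EuclideanSpace ℝ (Fin n) ↦ Real.exp (-b * ‖z‖ ^ 2)),
      GaussianFourier.integral_rexp_neg_mul_sq_norm hb, finrank_euclideanSpace_fin]
  exact ⟨Integrable.of_integral_ne_zero (h ▸ by positivity), h⟩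

/-- for `n ≥ 1`, `δ, γ, μ, T > 0` there is `c > 0` (depending only on these data)
such that for all `x ∈ ℝⁿ` and `t ∈ (0,T]`:
`∫ (1+|x−y|²/(4μt))^γ ψ_μ(x−y,t) (1+|y|²)^{−δ/2} dy ≤ c (1+|x|²)^{−δ/2}`. -/
theorem statement13 (n : ℕ) (hn : 1 ≤ n) (δ γ μ T : ℝ)
    (hδ : 0 < δ) (hγ : 0 < γ) (hμ : 0 < μ) (hT : 0 < T) :
    ∃ c : ℝ, 0 < c ∧
      ∀ (x : EuclideanSpace ℝ (Fin n)) (t : ℝ), 0 < t → t ≤ T →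
        (∫ y : EuclideanSpace ℝ (Fin n),
            (1 + ‖x - y‖ ^ 2 / (4 * μ * t)) ^ γ * heatK n μ (x - y) t *
              (1 + ‖y‖ ^ 2) ^ (-δ / 2))
          ≤ c * (1 + ‖x‖ ^ 2) ^ (-δ / 2) := by
  set p := δ / 2 with hp
  have hp0 : 0 < p := by positivity
  set C := (2 * (1 + 4 * μ * T)) ^ p
  set M := (2 * (γ + p)) ^ (γ + p) * Real.exp (1 / 2)
  have hC0 : 0 < C := by positivity
  have hM0 : 0 < M := by positivity
  refine ⟨C * M * 2 ^ ((n : ℝ) / 2), by positivity, fun x t ht htT ↦ ?_⟩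
  rw [neg_div, ← hp]
  set s := 4 * μ * t with hs
  have hs0 : 0 < s := by positivity
  have hsS : s ≤ 4 * μ * T := by rw [hs]; gcongr
  set P := (Real.pi * s) ^ (-((n : ℝ) / 2)) with hP
  have hP0 : 0 < P := by positivity
  have hheat (z : EuclideanSpace ℝ (Fin n)) : heatK n μ z t = P * Real.exp (-(‖z‖ ^ 2 / s)) := by
    rw [heatK, hP, hs, neg_div, neg_div]
    congr 2
    ring
  obtain ⟨hint, hval⟩ := integrable_and_integral_exp_neg_norm_sub_sq (b := 1 / (2 * s))
    (by positivity) x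
  have hbound (y : EuclideanSpace ℝ (Fin n)) :
      (1 + ‖x - y‖ ^ 2 / s) ^ γ * heatK n μ (x - y) t * (1 + ‖y‖ ^ 2) ^ (-p) ≤
        C * M * P * (1 + ‖x‖ ^ 2) ^ (-p) * Real.exp (-(1 / (2 * s)) * ‖x - y‖ ^ 2) := by
    have hexp : -(1 / (2 * s)) * ‖x - y‖ ^ 2 =
        ‖x - y‖ ^ 2 / s / 2 + -(‖x - y‖ ^ 2 / s) := by
      field_simp
      ring
    rw [hheat, hexp, Real.exp_add]
    have hpeetre := one_add_norm_sq_rpow_neg_le hp0.le hs0 hsS x y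
    have hr : 0 ≤ ‖x - y‖ ^ 2 / s := by positivity
    set r := ‖x - y‖ ^ 2 / s
    calc (1 + r) ^ γ * (P * Real.exp (-r)) * (1 + ‖y‖ ^ 2) ^ (-p)
        ≤ (1 + r) ^ γ * (P * Real.exp (-r)) * (C * (1 + r) ^ p * (1 + ‖x‖ ^ 2) ^ (-p)) := by
          gcongr
      _ = C * (1 + r) ^ (γ + p) * P * (1 + ‖x‖ ^ 2) ^ (-p) * Real.exp (-r) := by
          rw [Real.rpow_add (by positivity)]
          ring
      _ ≤ C * (M * Real.exp (r / 2)) * P * (1 + ‖x‖ ^ 2) ^ (-p) * Real.exp (-r) := by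
          gcongr
          exact one_add_rpow_le_exp_half (by positivity) hr
      _ = _ := by ring
  calc ∫ y, (1 + ‖x - y‖ ^ 2 / s) ^ γ * heatK n μ (x - y) t * (1 + ‖y‖ ^ 2) ^ (-p)
      ≤ ∫ y, C * M * P * (1 + ‖x‖ ^ 2) ^ (-p) * Real.exp (-(1 / (2 * s)) * ‖x - y‖ ^ 2) := by
        refine integral_mono_of_nonneg (.of_forall fun y ↦ ?_) (hint.const_mul _)
          (.of_forall hbound)
        simp only [Pi.zero_apply, hheat]
        positivity
    _ = C * M * 2 ^ ((n : ℝ) / 2) * (1 + ‖x‖ ^ 2) ^ (-p) := by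
        have hsplit : Real.pi / (1 / (2 * s)) = 2 * (Real.pi * s) := by
          field_simp
        have hcancel : P * (Real.pi * s) ^ ((n : ℝ) / 2) = 1 := by
          rw [hP, Real.rpow_neg (by positivity), inv_mul_cancel₀ (by positivity)]
        rw [integral_const_mul, hval, hsplit, Real.mul_rpow (by positivity) (by positivity)]
        linear_combination C * M * 2 ^ ((n : ℝ) / 2) * (1 + ‖x‖ ^ 2) ^ (-p) * hcancel
end

section
/- Let n ≥ 2, δ > 0, λ ∈ (0,1), μ > 0 and T > 0. There exists a constant c > 0 such that for every continuous u₀ : ℝⁿ → ℝ with A := sup_y w(y)^δ |u₀(y)| < ∞ and B := sup_{x≠y} w(x,y)^{δ+λ} |u₀(x)−u₀(y)|/|x−y|^λ < ∞, the Poisson potential (Ψ_{μ,0} u₀)(x,t) = ∫_{ℝⁿ} ψ_μ(x−y, t) u₀(y) dy satisfies, for all x, y ∈ ℝⁿ and t, t′, t″ ∈ (0,T]: (i) w(x)^δ |(Ψ_{μ,0}u₀)(x,t)| ≤ c A; (ii) w(x,y)^{δ+λ} |(Ψ_{μ,0}u₀)(x,t) − (Ψ_{μ,0}u₀)(y,t)|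 ≤ c B |x−y|^λ; (iii) w(x)^δ |(Ψ_{μ,0}u₀)(x,t′) − (Ψ_{μ,0}u₀)(x,t″)| ≤ c B |t′−t″|^{λ/2}. -/
open MeasureTheory

/-- The weight `w(x) = √(1+|x|²)`. -/
noncomputable def wgt {n : ℕ} (x : EuclideanSpace ℝ (Fin n)) : ℝ := Real.sqrt (1 + ‖x‖ ^ 2)

/-- The Poisson (heat) potential `(Ψ_{μ,0} u₀)(x,t) = ∫ ψ_μ(x−y,t) u₀(y) dy`. -/
noncomputable def poisson (n : ℕ) (μ : ℝ) (u₀ : EuclideanSpace ℝ (Fin n) → ℝ)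
    (x : EuclideanSpace ℝ (Fin n)) (t : ℝ) : ℝ :=
  ∫ y : EuclideanSpace ℝ (Fin n), heatK n μ (x - y) t * u₀ y

theorem one_le_wgt {n : ℕ} (x : EuclideanSpace ℝ (Fin n)) : 1 ≤ wgt x := by
  unfold wgt
  rw [Real.one_le_sqrt]
  nlinarith [sq_nonneg ‖x‖]

/-- A Peetre-type inequality for the weight. -/
theorem wgt_le_mul {n : ℕ} (x s : EuclideanSpace ℝ (Fin n)) :
    wgt x ≤ wgt (x - s) * (1 + ‖s‖) := by
  unfold wgt
  rw [Real.sqrt_le_left (by positivity), mul_pow, Real.sq_sqrt (by positivity)]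
  have h1 : ‖x‖ ≤ ‖x - s‖ + ‖s‖ := by simpa using norm_add_le (x - s) s
  have h2 : ‖x‖ ^ 2 ≤ (‖x - s‖ + ‖s‖) ^ 2 := by gcongr
  have ha := norm_nonneg (x - s)
  have hs := norm_nonneg s
  nlinarith [mul_nonneg hs (sq_nonneg (‖x - s‖ - 1)), mul_nonneg hs (sq_nonneg ‖x - s‖),
    mul_nonneg (sq_nonneg ‖s‖) (sq_nonneg ‖x - s‖)]

theorem heatK_nonneg {n : ℕ} {μ t : ℝ} (hμ : 0 ≤ μ) (ht : 0 ≤ t)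
    (x : EuclideanSpace ℝ (Fin n)) : 0 ≤ heatK n μ x t := by
  unfold heatK
  have := Real.pi_pos
  positivity

theorem continuous_heatK (n : ℕ) (μ t : ℝ) : Continuous fun x ↦ heatK n μ x t := by
  unfold heatK
  fun_prop

/-- Parabolic scaling of the heat kernel. -/
theorem heatK_sqrt_smul {n : ℕ} {μ t : ℝ} (hμ : 0 < μ) (ht : 0 < t)
    (z : EuclideanSpace ℝ (Fin n)) :
    Real.sqrt t ^ n * heatK n μ (Real.sqrt t • z) t = heatK n μ z 1 := by
  unfold heatK
  have hπ := Real.pi_pos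
  have h1 : Real.sqrt t ^ n = t ^ ((n : ℝ) / 2) := by
    rw [Real.sqrt_eq_rpow, ← Real.rpow_natCast, ← Real.rpow_mul ht.le]
    congr 1
    ring
  have h2 : -‖Real.sqrt t • z‖ ^ 2 / (4 * μ * t) = -‖z‖ ^ 2 / (4 * μ * 1) := by
    rw [norm_smul, mul_pow, Real.norm_eq_abs, sq_abs, Real.sq_sqrt ht.le]
    field_simp
  rw [h1, h2, Real.mul_rpow (by positivity) ht.le, mul_one, ← mul_assoc, mul_comm (t ^ _),
    mul_assoc (_ ^ _), ← Real.rpow_add ht]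
  have h3 : -(n : ℝ) / 2 + (n : ℝ) / 2 = 0 := by ring
  rw [h3, Real.rpow_zero, mul_one, mul_one]

/-- The Poisson potential written with the heat kernel at unit time. -/
theorem poisson_eq_integral_unit_time {n : ℕ} {μ t : ℝ} (hμ : 0 < μ) (ht : 0 < t)
    (u₀ : EuclideanSpace ℝ (Fin n) → ℝ) (x : EuclideanSpace ℝ (Fin n)) :
    poisson n μ u₀ x t = ∫ z, heatK n μ z 1 * u₀ (x - Real.sqrt t • z) := by
  have hs : 0 < Real.sqrt t := Real.sqrt_pos.2 ht
  have h1 : poisson n μ u₀ x t = ∫ z, heatK n μ z t * u₀ (x - z) := by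
    unfold poisson
    rw [← integral_sub_left_eq_self (fun z ↦ heatK n μ z t * u₀ (x - z)) volume x]
    simp
  have h2 := Measure.integral_comp_smul (volume : Measure (EuclideanSpace ℝ (Fin n)))
    (fun z ↦ heatK n μ z t * u₀ (x - z)) (Real.sqrt t)
  rw [finrank_euclideanSpace_fin, abs_of_pos (by positivity), smul_eq_mul, ← h1] at h2
  have h3 : poisson n μ u₀ x t = Real.sqrt t ^ n *
      ∫ z, heatK n μ (Real.sqrt t • z) t * u₀ (x - Real.sqrt t • z) := by
    rw [h2]
    field_simp
  rw [h3, ← integral_const_mul]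
  congr 1
  ext z
  rw [← heatK_sqrt_smul hμ ht z, mul_assoc]

theorem integrable_exp_neg_mul_norm_sq {n : ℕ} {b : ℝ} (hb : 0 < b) :
    Integrable fun z : EuclideanSpace ℝ (Fin n) ↦ Real.exp (-b * ‖z‖ ^ 2) := by
  have h := (GaussianFourier.integrable_cexp_neg_mul_sq_norm_add (b := (b : ℂ)) (by simpa using hb)
    0 (0 : EuclideanSpace ℝ (Fin n))).norm
  refine h.congr (Filter.Eventually.of_forall fun z ↦ ?_)
  simp only [zero_mul, add_zero, Complex.norm_exp]
  congr 1
  norm_cast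

/-- The heat kernel at unit time has finite moments of all orders. -/
theorem integrable_heatK_mul_rpow {n : ℕ} {μ p k : ℝ} (hμ : 0 < μ) (hp : 0 ≤ p) (hk : 0 ≤ k) :
    Integrable fun z : EuclideanSpace ℝ (Fin n) ↦ heatK n μ z 1 * (k * (1 + ‖z‖)) ^ p := by
  set b : ℝ := 1 / (4 * μ) with hb
  have hb0 : 0 < b := by positivity
  have hπ := Real.pi_pos
  refine ((integrable_exp_neg_mul_norm_sq (n := n) (half_pos hb0)).const_mul
    ((4 * Real.pi * μ * 1) ^ (-(n : ℝ) / 2) * k ^ p * Real.exp (p ^ 2 / (2 * b)))).mono' ?_ ?_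
  · refine Continuous.aestronglyMeasurable ?_
    refine (continuous_heatK n μ 1).mul (Continuous.rpow_const (by fun_prop) fun z ↦ Or.inr hp)
  · refine Filter.Eventually.of_forall fun z ↦ ?_
    have hz := norm_nonneg z
    rw [Real.norm_of_nonneg (mul_nonneg (heatK_nonneg hμ.le zero_le_one z) (by positivity)),
      Real.mul_rpow hk (by positivity)]
    have h1 : (1 + ‖z‖) ^ p ≤ Real.exp (p * ‖z‖) := by
      rw [mul_comm, Real.exp_mul]
      gcongr
      linarith [Real.add_one_le_exp ‖z‖]
    have h2 : p * ‖z‖ ≤ p ^ 2 / (2 * b) + b / 2 * ‖z‖ ^ 2 := by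
      have : p ^ 2 / (2 * b) + b / 2 * ‖z‖ ^ 2 - p * ‖z‖ = (p - b * ‖z‖) ^ 2 / (2 * b) := by
        field_simp
        ring
      have : 0 ≤ (p - b * ‖z‖) ^ 2 / (2 * b) := by positivity
      linarith
    have h3 : -‖z‖ ^ 2 / (4 * μ * 1) = -b * ‖z‖ ^ 2 := by
      rw [hb]
      field_simp
    unfold heatK
    rw [h3]
    calc _ = (4 * Real.pi * μ * 1) ^ (-(n : ℝ) / 2) * k ^ p *
          (Real.exp (-b * ‖z‖ ^ 2) * (1 + ‖z‖) ^ p) := by ring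
      _ ≤ (4 * Real.pi * μ * 1) ^ (-(n : ℝ) / 2) * k ^ p *
          (Real.exp (-b * ‖z‖ ^ 2) *
            Real.exp (p ^ 2 / (2 * b) + b / 2 * ‖z‖ ^ 2)) := by
        gcongr
        exact h1.trans (Real.exp_le_exp.2 h2)
      _ = _ := by
        rw [← Real.exp_add, mul_assoc _ (Real.exp _) (Real.exp _), ← Real.exp_add]
        congr 2
        ring

/-- A pointwise bound `a |f z| ≤ D M z` with `D, a ≥ 0` passes to integrals against a
nonnegative kernel. -/
theorem mul_abs_integral_le {α : Type*} [MeasurableSpace α] {ν : Measure α} {g f M : α → ℝ}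
    {a D : ℝ} (ha : 0 ≤ a) (hg : ∀ z, 0 ≤ g z) (hM : Integrable (fun z ↦ g z * M z) ν)
    (h : ∀ z, a * |f z| ≤ D * M z) :
    a * |∫ z, g z * f z ∂ν| ≤ (∫ z, g z * M z ∂ν) * D := by
  rw [← abs_of_nonneg ha, ← abs_mul, ← integral_const_mul, ← integral_mul_const,
    ← Real.norm_eq_abs]
  refine norm_integral_le_of_norm_le (hM.mul_const D) (Filter.Eventually.of_forall fun z ↦ ?_)
  rw [Real.norm_eq_abs, abs_mul, abs_mul, abs_of_nonneg ha, abs_of_nonneg (hg z)]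
  calc a * (g z * |f z|) = g z * (a * |f z|) := by ring
    _ ≤ g z * (D * M z) := mul_le_mul_of_nonneg_left (h z) (hg z)
    _ = g z * M z * D := by ring

theorem abs_sqrt_sub_sqrt_le {s t : ℝ} (hs : 0 ≤ s) (ht : 0 ≤ t) :
    |Real.sqrt s - Real.sqrt t| ≤ Real.sqrt |s - t| := by
  refine Real.le_sqrt_of_sq_le ?_
  have h : |s - t| = |Real.sqrt s - Real.sqrt t| * (Real.sqrt s + Real.sqrt t) := by
    rw [← abs_of_nonneg (add_nonneg (Real.sqrt_nonneg s) (Real.sqrt_nonneg t)), ← abs_mul]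
    congr 1
    nlinarith [Real.sq_sqrt hs, Real.sq_sqrt ht]
  rw [h, sq]
  gcongr
  rw [abs_le]
  constructor <;> linarith [Real.sqrt_nonneg s, Real.sqrt_nonneg t]

/-- weighted estimates for the Poisson potential: there is `c > 0` such that for
every continuous `u₀` with `w^δ|u₀| ≤ A` and weighted Hölder seminorm bounded by `B`:
(i) `w(x)^δ |Ψ_{μ,0}u₀(x,t)| ≤ c A`;
(ii) `w(x,y)^{δ+λ} |Ψ_{μ,0}u₀(x,t) − Ψ_{μ,0}u₀(y,t)| ≤ c B |x−y|^λ`;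
(iii) `w(x)^δ |Ψ_{μ,0}u₀(x,t′) − Ψ_{μ,0}u₀(x,t″)| ≤ c B |t′−t″|^{λ/2}`. -/
theorem statement14 (n : ℕ) (hn : 2 ≤ n) (δ lam μ T : ℝ)
    (hδ : 0 < δ) (hlam0 : 0 < lam) (hlam1 : lam < 1) (hμ : 0 < μ) (hT : 0 < T) :
    ∃ c : ℝ, 0 < c ∧
      ∀ (u₀ : EuclideanSpace ℝ (Fin n) → ℝ) (A B : ℝ), Continuous u₀ →
        (∀ y, wgt y ^ δ * |u₀ y| ≤ A) →
        (∀ x y : EuclideanSpace ℝ (Fin n), x ≠ y →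
          (max (wgt x) (wgt y)) ^ (δ + lam) * |u₀ x - u₀ y| ≤ B * ‖x - y‖ ^ lam) →
        (∀ (x : EuclideanSpace ℝ (Fin n)) (t : ℝ), 0 < t → t ≤ T →
            wgt x ^ δ * |poisson n μ u₀ x t| ≤ c * A) ∧
        (∀ (x y : EuclideanSpace ℝ (Fin n)) (t : ℝ), 0 < t → t ≤ T →
            (max (wgt x) (wgt y)) ^ (δ + lam) * |poisson n μ u₀ x t - poisson n μ u₀ y t|
              ≤ c * B * ‖x - y‖ ^ lam) ∧
        (∀ (x : EuclideanSpace ℝ (Fin n)) (t' t'' : ℝ), 0 < t' → t' ≤ T → 0 < t'' → t'' ≤ T →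
            wgt x ^ δ * |poisson n μ u₀ x t' - poisson n μ u₀ x t''|
              ≤ c * B * |t' - t''| ^ (lam / 2)) := by
  set k : ℝ := 1 + Real.sqrt T with hk
  have hk1 : 1 ≤ k := by linarith [Real.sqrt_nonneg T]
  set p : ℝ := δ + lam + lam with hp
  set M : EuclideanSpace ℝ (Fin n) → ℝ := fun z ↦ (k * (1 + ‖z‖)) ^ p
  have hG : ∀ z : EuclideanSpace ℝ (Fin n), 0 ≤ heatK n μ z 1 :=
    heatK_nonneg hμ.le zero_le_one
  have hMint : Integrable fun z ↦ heatK n μ z 1 * M z :=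
    integrable_heatK_mul_rpow hμ (by positivity) (by positivity)
  have hGint : Integrable fun z : EuclideanSpace ℝ (Fin n) ↦ heatK n μ z 1 := by
    simpa using integrable_heatK_mul_rpow (n := n) (p := 0) (k := 1) hμ le_rfl zero_le_one
  set I : ℝ := ∫ z, heatK n μ z 1 * M z
  have hI0 : 0 ≤ I := integral_nonneg fun z ↦ mul_nonneg (hG z) (by positivity)
  have hbase : ∀ z : EuclideanSpace ℝ (Fin n), 1 ≤ k * (1 + ‖z‖) := fun z ↦
    one_le_mul_of_one_le_of_one_le hk1 (by linarith [norm_nonneg z])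
  have hw0 : ∀ x : EuclideanSpace ℝ (Fin n), 0 ≤ wgt x := fun x ↦
    zero_le_one.trans (one_le_wgt x)
  have hshift : ∀ (x z : EuclideanSpace ℝ (Fin n)) (t : ℝ), t ≤ T →
      wgt x ≤ wgt (x - Real.sqrt t • z) * (k * (1 + ‖z‖)) := by
    intro x z t htT
    refine (wgt_le_mul x (Real.sqrt t • z)).trans
      (mul_le_mul_of_nonneg_left ?_ (hw0 _))
    rw [norm_smul, Real.norm_of_nonneg (Real.sqrt_nonneg t)]
    have := Real.sqrt_le_sqrt htT
    have hT0 := Real.sqrt_nonneg T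
    nlinarith [norm_nonneg z, mul_le_mul_of_nonneg_right this (norm_nonneg z)]
  have hpow : ∀ (z : EuclideanSpace ℝ (Fin n)) (q : ℝ), q ≤ p → (k * (1 + ‖z‖)) ^ q ≤ M z :=
    fun z q hq ↦ Real.rpow_le_rpow_of_exponent_le (hbase z) hq
  refine ⟨I + 1, by positivity, fun u₀ A B hu hA hB ↦ ?_⟩
  have hA0 : 0 ≤ A := le_trans (mul_nonneg (Real.rpow_nonneg (hw0 0) _) (abs_nonneg _)) (hA 0)
  have hB0 : 0 ≤ B := by
    have : Nonempty (Fin n) := ⟨⟨0, by omega⟩⟩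
    obtain ⟨x, hx⟩ := exists_ne (0 : EuclideanSpace ℝ (Fin n))
    have hx0 : 0 < ‖x - 0‖ ^ lam := Real.rpow_pos_of_pos (by simpa using hx) _
    refine nonneg_of_mul_nonneg_left (le_trans ?_ (hB x 0 hx)) hx0
    exact mul_nonneg (Real.rpow_nonneg ((hw0 x).trans (le_max_left _ _)) _) (abs_nonneg _)
  have hB' : ∀ x y : EuclideanSpace ℝ (Fin n),
      (max (wgt x) (wgt y)) ^ (δ + lam) * |u₀ x - u₀ y| ≤ B * ‖x - y‖ ^ lam := by
    intro x y
    rcases eq_or_ne x y with rfl | h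
    · simp only [sub_self, abs_zero, mul_zero]
      positivity
    · exact hB x y h
  have hbdd : ∀ y, |u₀ y| ≤ A := fun y ↦
    (le_mul_of_one_le_left (abs_nonneg _) (Real.one_le_rpow (one_le_wgt y) hδ.le)).trans (hA y)
  have hu_int : ∀ (x : EuclideanSpace ℝ (Fin n)) (t : ℝ),
      Integrable fun z ↦ heatK n μ z 1 * u₀ (x - Real.sqrt t • z) := fun x t ↦
    hGint.mul_bdd (c := A) (Continuous.aestronglyMeasurable (by fun_prop))
      (Filter.Eventually.of_forall fun z ↦ hbdd _)
  have hdiff : ∀ (x y : EuclideanSpace ℝ (Fin n)) (s t : ℝ), 0 < s → 0 < t →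
      poisson n μ u₀ x s - poisson n μ u₀ y t = ∫ z, heatK n μ z 1 *
        (u₀ (x - Real.sqrt s • z) - u₀ (y - Real.sqrt t • z)) := by
    intro x y s t hs ht
    rw [poisson_eq_integral_unit_time hμ hs, poisson_eq_integral_unit_time hμ ht,
      ← integral_sub (hu_int x s) (hu_int y t)]
    simp only [mul_sub]
  refine ⟨fun x t ht htT ↦ ?_, fun x y t ht htT ↦ ?_, fun x s t hs hsT ht htT ↦ ?_⟩
  · rw [poisson_eq_integral_unit_time hμ ht]
    refine (mul_abs_integral_le (D := A) (Real.rpow_nonneg (hw0 x) _) hG hMint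
      fun z ↦ ?_).trans (mul_le_mul_of_nonneg_right (by linarith) hA0)
    set y := x - Real.sqrt t • z with hy
    have hz := hbase z
    calc wgt x ^ δ * |u₀ y| ≤ (wgt y * (k * (1 + ‖z‖))) ^ δ * |u₀ y| := by
          gcongr
          · exact hw0 x
          · exact hshift x z t htT
      _ = wgt y ^ δ * |u₀ y| * (k * (1 + ‖z‖)) ^ δ := by
          rw [Real.mul_rpow (hw0 y) (by linarith)]
          ring
      _ ≤ A * M z := by
          gcongr
          · exact hA y
          · exact hpow z δ (by linarith)
  · rw [hdiff x y t t ht ht]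
    have hm0 : 0 ≤ max (wgt x) (wgt y) := (hw0 x).trans (le_max_left _ _)
    rw [mul_assoc (I + 1)]
    refine (mul_abs_integral_le (D := B * ‖x - y‖ ^ lam) (Real.rpow_nonneg hm0 _) hG hMint
      fun z ↦ ?_).trans (mul_le_mul_of_nonneg_right (by linarith) (by positivity))
    have hx := hshift x z t htT
    have hy := hshift y z t htT
    have hxy : ‖x - y‖ = ‖(x - Real.sqrt t • z) - (y - Real.sqrt t • z)‖ := by
      rw [sub_sub_sub_cancel_right]
    rw [hxy]
    set x' := x - Real.sqrt t • z
    set y' := y - Real.sqrt t • z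
    have hz := hbase z
    have hm0' : 0 ≤ max (wgt x') (wgt y') := (hw0 x').trans (le_max_left _ _)
    have hmax : max (wgt x) (wgt y) ≤ max (wgt x') (wgt y') * (k * (1 + ‖z‖)) := by
      rw [max_mul_of_nonneg _ _ (by linarith)]
      exact max_le_max hx hy
    calc max (wgt x) (wgt y) ^ (δ + lam) * |u₀ x' - u₀ y'|
        ≤ (max (wgt x') (wgt y') * (k * (1 + ‖z‖))) ^ (δ + lam) * |u₀ x' - u₀ y'| := by
          gcongr
      _ = max (wgt x') (wgt y') ^ (δ + lam) * |u₀ x' - u₀ y'| * (k * (1 + ‖z‖)) ^ (δ + lam) := by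
          rw [Real.mul_rpow hm0' (by linarith)]
          ring
      _ ≤ B * ‖x' - y'‖ ^ lam * M z := by
          exact mul_le_mul (hB' x' y') (hpow z _ (by linarith)) (by positivity) (by positivity)
  · rw [hdiff x x s t hs ht, mul_assoc (I + 1)]
    refine (mul_abs_integral_le (D := B * |s - t| ^ (lam / 2)) (Real.rpow_nonneg (hw0 x) _) hG
      hMint fun z ↦ ?_).trans (mul_le_mul_of_nonneg_right (by linarith) (by positivity))
    have hx := hshift x z s hsT
    have hdist : ‖(x - Real.sqrt s • z) - (x - Real.sqrt t • z)‖ ≤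
        Real.sqrt |s - t| * (k * (1 + ‖z‖)) := by
      rw [sub_sub_sub_cancel_left, ← sub_smul, norm_smul, Real.norm_eq_abs, abs_sub_comm]
      gcongr
      · exact abs_sqrt_sub_sqrt_le hs.le ht.le
      · nlinarith [norm_nonneg z]
    set x' := x - Real.sqrt s • z
    set y' := x - Real.sqrt t • z
    have hz := hbase z
    have hm0' : 0 ≤ max (wgt x') (wgt y') := (hw0 x').trans (le_max_left _ _)
    have hsq : Real.sqrt |s - t| ^ lam = |s - t| ^ (lam / 2) := by
      rw [Real.sqrt_eq_rpow, ← Real.rpow_mul (abs_nonneg _)]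
      congr 1
      ring
    calc wgt x ^ δ * |u₀ x' - u₀ y'| ≤ wgt x ^ (δ + lam) * |u₀ x' - u₀ y'| := by
          gcongr
          · exact one_le_wgt x
          · linarith
      _ ≤ (max (wgt x') (wgt y') * (k * (1 + ‖z‖))) ^ (δ + lam) * |u₀ x' - u₀ y'| := by
          gcongr
          · exact hw0 x
          · exact hx.trans (mul_le_mul_of_nonneg_right (le_max_left _ _) (by linarith))
      _ = max (wgt x') (wgt y') ^ (δ + lam) * |u₀ x' - u₀ y'| * (k * (1 + ‖z‖)) ^ (δ + lam) := by
          rw [Real.mul_rpow hm0' (by linarith)]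
          ring
      _ ≤ B * (Real.sqrt |s - t| * (k * (1 + ‖z‖))) ^ lam * (k * (1 + ‖z‖)) ^ (δ + lam) := by
          exact mul_le_mul_of_nonneg_right ((hB' x' y').trans (by gcongr)) (by positivity)
      _ = B * |s - t| ^ (lam / 2) * M z := by
          have hMz : M z = (k * (1 + ‖z‖)) ^ (δ + lam) * (k * (1 + ‖z‖)) ^ lam := by
            rw [← Real.rpow_add (by linarith)]
          rw [Real.mul_rpow (Real.sqrt_nonneg _) (by linarith), hsq, hMz]
          ring
end

section
/- Let n ≥ 2, μ > 0, T > 0 and δ ∈ ℝ (δ may be negative, so polynomial growth is allowed). Suppose u : ℝⁿ × [0,T] → ℝ is continuous, its derivatives ∂_t u and ∂_i∂_j u (i,j = 1,…,n) exist and are continuous on ℝⁿ × (0,T), u satisfies the heat equation ∂_t u = μ Δu on ℝⁿ × (0,T), u(x,0) = 0 for all x ∈ ℝⁿ, and there is M ≥ 0 with |u(x,t)| ≤ M (1+|x|²)^{−δ/2} for all (x,t) ∈ ℝⁿ × [0,T]. Then u ≡ 0 on ℝⁿ × [0,T]. (Consequently the Cauchy problem for the heat operator H_μ = ∂_t − μΔ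 has at most one solution in each weighted class C^{s(1,λ,δ)}.) -/
/-- Spatial partial derivative in the `i`-th coordinate direction of a time-dependent scalar
field `u(x,t)` on `ℝⁿ × ℝ`. -/
noncomputable def pdx {n : ℕ} (i : Fin n) (f : EuclideanSpace ℝ (Fin n) → ℝ → ℝ) :
    EuclideanSpace ℝ (Fin n) → ℝ → ℝ :=
  fun x t => fderiv ℝ (fun y => f y t) x (EuclideanSpace.single i 1)

open Set Filter Topology

/-- Second-order necessary condition at a local maximum. -/
theorem nonpos_of_isLocalMax_of_hasDerivAt_hasDerivAt {f f' : ℝ → ℝ} {a L : ℝ}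
    (hf : ∀ s, HasDerivAt f (f' s) s) (hf' : HasDerivAt f' L a) (hmax : IsLocalMax f a) :
    L ≤ 0 := by
  by_contra! hL
  have hderiv : deriv f = f' := funext fun s => (hf s).deriv
  have hmin : IsLocalMin f a := by
    refine isLocalMin_of_deriv_deriv_pos ?_ hmax.deriv_eq_zero (hf a).continuousAt
    rwa [hderiv, hf'.deriv]
  have hconst : f =ᶠ[𝓝 a] fun _ => f a := by
    filter_upwards [hmin, hmax] with s h₁ h₂ using le_antisymm h₂ h₁
  have hzero : f' =ᶠ[𝓝 a] fun _ => 0 := by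
    have h := hconst.deriv
    rw [hderiv] at h
    filter_upwards [h] with s hs
    simpa using hs
  have : L = 0 := hf'.unique ((hasDerivAt_const a (0 : ℝ)).congr_of_eventuallyEq hzero)
  exact hL.ne' this

/-- First-order necessary condition at a maximum from the left. -/
theorem nonneg_of_hasDerivAt_of_forall_le {f : ℝ → ℝ} {a b d : ℝ} (hab : a < b)
    (hf : HasDerivAt f d b) (hmax : ∀ t ∈ Icc a b, f t ≤ f b) : 0 ≤ d := by
  have h := (hasDerivAt_iff_tendsto_slope_left_right.1 hf).1
  refine ge_of_tendsto h ?_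
  filter_upwards [Ioo_mem_nhdsLT hab] with t ht
  rw [slope_def_field]
  exact div_nonneg_of_nonpos (by linarith [hmax t ⟨ht.1.le, ht.2.le⟩]) (by linarith [ht.2])

theorem one_add_norm_sq_add_smul_single {n : ℕ} (x : EuclideanSpace ℝ (Fin n)) (i : Fin n)
    (s : ℝ) :
    1 + ‖x + s • EuclideanSpace.single i (1 : ℝ)‖ ^ 2 = 1 + ‖x‖ ^ 2 + 2 * s * x i + s ^ 2 := by
  rw [norm_add_sq_real, inner_smul_right, norm_smul, EuclideanSpace.inner_single_right]
  simp
  ring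

/-- One-sided maximum principle for the heat equation under polynomial growth: `D₁ i`, `D₂ i` are the first and second
derivatives of `u` in the `i`-th coordinate direction. -/
theorem heat_le_zero_of_poly_growth {n : ℕ} {μ T M : ℝ} (hμ : 0 < μ) (hM : 0 ≤ M) (k : ℕ)
    {u : EuclideanSpace ℝ (Fin n) → ℝ → ℝ} {D₁ D₂ : Fin n → EuclideanSpace ℝ (Fin n) → ℝ → ℝ}
    (hcont : ContinuousOn (fun z : EuclideanSpace ℝ (Fin n) × ℝ => u z.1 z.2)
      (univ ×ˢ Icc (0 : ℝ) T))
    (hD₁ : ∀ i x t, 0 < t → t < T → ∀ s : ℝ,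
      HasDerivAt (fun s => u (x + s • EuclideanSpace.single i (1 : ℝ)) t)
        (D₁ i (x + s • EuclideanSpace.single i (1 : ℝ)) t) s)
    (hD₂ : ∀ i x t, 0 < t → t < T →
      HasDerivAt (fun s : ℝ => D₁ i (x + s • EuclideanSpace.single i (1 : ℝ)) t) (D₂ i x t) 0)
    (hheat : ∀ x t, 0 < t → t < T → HasDerivAt (u x) (μ * ∑ i, D₂ i x t) t)
    (hinit : ∀ x, u x 0 ≤ 0)
    (hbound : ∀ x, ∀ t ∈ Icc (0 : ℝ) T, u x t ≤ M * (1 + ‖x‖ ^ 2) ^ k)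
    (x : EuclideanSpace ℝ (Fin n)) {t : ℝ} (ht : t ∈ Ico (0 : ℝ) T) : u x t ≤ 0 := by
  set q : EuclideanSpace ℝ (Fin n) → ℝ := fun y => 1 + ‖y‖ ^ 2 with hq
  have hq1 : ∀ y, 1 ≤ q y := fun y => by simp only [hq]; nlinarith [sq_nonneg ‖y‖]
  obtain ⟨A, hA⟩ : ∃ A : ℝ, A = 4 * ((k : ℝ) + 2) * (k + 1) + 2 * (k + 2) * n := ⟨_, rfl⟩
  obtain ⟨K, hK⟩ : ∃ K : ℝ, K = μ * A + 1 := ⟨_, rfl⟩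
  have hApos : 0 ≤ A := by rw [hA]; positivity
  have hKpos : 0 ≤ K := by rw [hK]; positivity
  -- comparison with the strict supersolution `ε * exp (K t) * (1 + ‖x‖²) ^ (k + 2)`
  have key : ∀ ε : ℝ, 0 < ε → u x t ≤ ε * (Real.exp (K * t) * q x ^ (k + 2)) := by
    intro ε hε
    by_contra! hlt
    set v : EuclideanSpace ℝ (Fin n) × ℝ → ℝ := fun z =>
      u z.1 z.2 - ε * (Real.exp (K * z.2) * q z.1 ^ (k + 2)) with hv
    have hvpos : 0 < v (x, t) := by simp only [hv]; linarith
    have hfar : ∀ y, M / ε ≤ ‖y‖ ^ 2 → ∀ τ ∈ Icc (0 : ℝ) t, v (y, τ) ≤ 0 := by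
      intro y hy τ hτ
      have h1 := hbound y τ ⟨hτ.1, hτ.2.trans ht.2.le⟩
      have h2 : M ≤ ε * q y := by
        rw [div_le_iff₀ hε] at hy
        simp only [hq]; nlinarith
      have h3 : (1 : ℝ) ≤ Real.exp (K * τ) := Real.one_le_exp (mul_nonneg hKpos hτ.1)
      have hqp : 0 < q y ^ k := pow_pos (by linarith [hq1 y]) k
      have h4 : M * q y ^ k ≤ ε * q y ^ (k + 2) := by
        have : M ≤ ε * q y ^ 2 := by
          nlinarith [hq1 y, mul_nonneg hε.le (mul_nonneg (by linarith [hq1 y] : 0 ≤ q y)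
            (sub_nonneg.2 (hq1 y)))]
        calc M * q y ^ k ≤ (ε * q y ^ 2) * q y ^ k := by gcongr
          _ = _ := by ring
      have h5 : ε * q y ^ (k + 2) ≤ ε * (Real.exp (K * τ) * q y ^ (k + 2)) := by
        have : 0 ≤ q y ^ (k + 2) := pow_nonneg (by linarith [hq1 y]) _
        gcongr
        exact le_mul_of_one_le_left this h3
      simp only [hv]
      linarith
    obtain ⟨R, hRx, hR⟩ : ∃ R : ℝ, ‖x‖ ≤ R ∧ ∀ y : EuclideanSpace ℝ (Fin n), R < ‖y‖ →
        M / ε ≤ ‖y‖ ^ 2 := by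
      have hMε : 0 ≤ M / ε := by positivity
      refine ⟨max ‖x‖ (M / ε + 1), le_max_left _ _, fun y hy => ?_⟩
      have := (le_max_right _ _).trans_lt hy
      nlinarith
    have hcv : ContinuousOn v (Metric.closedBall 0 R ×ˢ Icc 0 t) := by
      have h1 := hcont.mono (prod_mono (subset_univ (Metric.closedBall 0 R))
        (Icc_subset_Icc_right ht.2.le))
      refine h1.sub (Continuous.continuousOn ?_)
      simp only [hq]
      fun_prop
    have hxt : (x, t) ∈ Metric.closedBall (0 : EuclideanSpace ℝ (Fin n)) R ×ˢ Icc 0 t :=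
      ⟨by simpa using hRx, ht.1, le_rfl⟩
    obtain ⟨⟨x₀, t₀⟩, ⟨-, ht₀⟩, hmaxOn⟩ :=
      ((isCompact_closedBall (0 : EuclideanSpace ℝ (Fin n)) R).prod
        (isCompact_Icc (a := (0 : ℝ)) (b := t))).exists_isMaxOn ⟨_, hxt⟩ hcv
    have hv₀ : 0 < v (x₀, t₀) := hvpos.trans_le (hmaxOn hxt)
    have hmax : ∀ y, ∀ τ ∈ Icc (0 : ℝ) t, v (y, τ) ≤ v (x₀, t₀) := by
      intro y τ hτ
      rcases le_or_gt ‖y‖ R with hy | hy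
      · exact hmaxOn (show (y, τ) ∈ _ from ⟨by simpa using hy, hτ⟩)
      · exact (hfar y (hR y hy) τ hτ).trans hv₀.le
    simp only at ht₀
    have hqpos : 0 < q x₀ := by linarith [hq1 x₀]
    have ht₀pos : 0 < t₀ := by
      refine ht₀.1.lt_of_ne ?_
      rintro rfl
      have : 0 ≤ ε * (Real.exp (K * 0) * q x₀ ^ (k + 2)) := by positivity
      have h2 := hinit x₀
      simp only [hv] at hv₀
      linarith
    have ht₀T : t₀ < T := ht₀.2.trans_lt ht.2
    obtain ⟨c, hc⟩ : ∃ c : ℝ, c = ε * Real.exp (K * t₀) := ⟨_, rfl⟩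
    have hcpos : 0 < c := by rw [hc]; positivity
    have htime : 0 ≤ μ * ∑ i, D₂ i x₀ t₀ - c * K * q x₀ ^ (k + 2) := by
      have hd : HasDerivAt (fun τ => v (x₀, τ))
          (μ * ∑ i, D₂ i x₀ t₀ - c * K * q x₀ ^ (k + 2)) t₀ := by
        have he := ((((hasDerivAt_id t₀).const_mul K).exp).mul_const (q x₀ ^ (k + 2))).const_mul ε
        refine ((hheat x₀ t₀ ht₀pos ht₀T).sub he).congr_deriv ?_
        rw [hc]
        simp only [id]
        ring
      exact nonneg_of_hasDerivAt_of_forall_le ht₀pos hd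
        fun τ hτ => hmax x₀ τ ⟨hτ.1, hτ.2.trans ht₀.2⟩
    have hspace : ∀ i, D₂ i x₀ t₀ ≤ c * (4 * ((k : ℝ) + 2) * (k + 1) * q x₀ ^ k * x₀ i ^ 2
        + 2 * (k + 2) * q x₀ ^ (k + 1)) := by
      intro i
      set Q : ℝ → ℝ := fun s => q x₀ + 2 * s * x₀ i + s ^ 2 with hQ
      have hQ' : ∀ s, HasDerivAt Q (2 * x₀ i + 2 * s) s := by
        intro s
        have h := (((hasDerivAt_id s).const_mul 2).mul_const (x₀ i)).const_add (q x₀)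
        refine (h.add (hasDerivAt_pow 2 s)).congr_deriv ?_
        simp
      have hlin : HasDerivAt (fun s : ℝ => 2 * x₀ i + 2 * s) 2 0 := by
        simpa using ((hasDerivAt_id (0 : ℝ)).const_mul 2).const_add (2 * x₀ i)
      have hf : ∀ s, HasDerivAt
          (fun s => u (x₀ + s • EuclideanSpace.single i (1 : ℝ)) t₀ - c * Q s ^ (k + 2))
          (D₁ i (x₀ + s • EuclideanSpace.single i (1 : ℝ)) t₀
            - c * (((k : ℝ) + 2) * (Q s ^ (k + 1) * (2 * x₀ i + 2 * s)))) s := by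
        intro s
        refine ((hD₁ i x₀ t₀ ht₀pos ht₀T s).sub
          (((hQ' s).pow (k + 2)).const_mul c)).congr_deriv ?_
        push_cast
        ring
      have hf' := (hD₂ i x₀ t₀ ht₀pos ht₀T).sub
        (((((hQ' 0).pow (k + 1)).mul hlin).const_mul ((k : ℝ) + 2)).const_mul c)
      have hval : ∀ s, v (x₀ + s • EuclideanSpace.single i (1 : ℝ), t₀) =
          u (x₀ + s • EuclideanSpace.single i (1 : ℝ)) t₀ - c * Q s ^ (k + 2) := by
        intro s
        simp only [hv, hq, hQ, hc, one_add_norm_sq_add_smul_single]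
        ring
      have hloc : IsLocalMax
          (fun s => u (x₀ + s • EuclideanSpace.single i (1 : ℝ)) t₀ - c * Q s ^ (k + 2)) 0 := by
        refine Eventually.of_forall fun s => ?_
        have h := hmax (x₀ + s • EuclideanSpace.single i (1 : ℝ)) t₀ ht₀
        have h0 := hval 0
        rw [zero_smul, add_zero] at h0
        simp only [zero_smul, add_zero]
        rw [← hval s, ← h0]
        exact h
      have h := nonpos_of_isLocalMax_of_hasDerivAt_hasDerivAt hf hf' hloc
      have hQ0 : Q 0 = q x₀ := by simp [hQ]
      simp only [hQ0, Pi.pow_apply, Nat.add_sub_cancel] at h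
      push_cast at h
      nlinarith [h]
    have hsum : ∑ i, D₂ i x₀ t₀ ≤ c * (A * q x₀ ^ (k + 2)) := by
      have hr : ∑ i, x₀ i ^ 2 = ‖x₀‖ ^ 2 := (EuclideanSpace.real_norm_sq_eq x₀).symm
      calc ∑ i, D₂ i x₀ t₀ ≤ ∑ i, c * (4 * ((k : ℝ) + 2) * (k + 1) * q x₀ ^ k * x₀ i ^ 2
            + 2 * (k + 2) * q x₀ ^ (k + 1)) := Finset.sum_le_sum fun i _ => hspace i
        _ = c * (4 * ((k : ℝ) + 2) * (k + 1) * q x₀ ^ k * ‖x₀‖ ^ 2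
            + 2 * (k + 2) * n * q x₀ ^ (k + 1)) := by
          rw [← Finset.mul_sum, Finset.sum_add_distrib, ← Finset.mul_sum, hr]
          rw [Finset.sum_const, Finset.card_univ, Fintype.card_fin, nsmul_eq_mul]
          ring
        _ ≤ c * (A * q x₀ ^ (k + 2)) := by
          have h1 : ‖x₀‖ ^ 2 ≤ q x₀ ^ 2 := by
            have : ‖x₀‖ ^ 2 ≤ q x₀ := by simp [hq]
            nlinarith [hq1 x₀]
          have h2 : q x₀ ^ (k + 1) ≤ q x₀ ^ (k + 2) := pow_le_pow_right₀ (hq1 x₀) (by omega)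
          have h3 : q x₀ ^ k * ‖x₀‖ ^ 2 ≤ q x₀ ^ (k + 2) := by
            rw [pow_add]; gcongr
          gcongr
          rw [hA, add_mul, mul_assoc _ (q x₀ ^ k)]
          gcongr
    have hfin : 0 < c * q x₀ ^ (k + 2) := by positivity
    have := mul_le_mul_of_nonneg_left hsum hμ.le
    rw [hK] at htime
    nlinarith
  have hlim : Tendsto (fun ε : ℝ => ε * (Real.exp (K * t) * q x ^ (k + 2))) (𝓝[>] 0) (𝓝 0) := by
    have h : Continuous fun ε : ℝ => ε * (Real.exp (K * t) * q x ^ (k + 2)) := by fun_prop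
    simpa using (h.tendsto 0).mono_left nhdsWithin_le_nhds
  exact ge_of_tendsto hlim (by filter_upwards [self_mem_nhdsWithin] with ε hε using key ε hε)

/-- Differentiating along a coordinate line computes the partial derivative. -/
theorem hasDerivAt_comp_add_smul_single {n : ℕ} {f : EuclideanSpace ℝ (Fin n) → ℝ → ℝ}
    {i : Fin n} {x : EuclideanSpace ℝ (Fin n)} {t s : ℝ}
    (hf : DifferentiableAt ℝ (fun y => f y t) (x + s • EuclideanSpace.single i (1 : ℝ))) :
    HasDerivAt (fun s : ℝ => f (x + s • EuclideanSpace.single i (1 : ℝ)) t)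
      (pdx i f (x + s • EuclideanSpace.single i (1 : ℝ)) t) s := by
  have hline : HasDerivAt (fun s : ℝ => x + s • EuclideanSpace.single i (1 : ℝ))
      (EuclideanSpace.single i (1 : ℝ)) s := by
    simpa using ((hasDerivAt_id s).smul_const (EuclideanSpace.single i (1 : ℝ))).const_add x
  exact hf.hasFDerivAt.comp_hasDerivAt s hline

/-- uniqueness for the Cauchy problem for the heat operator within classes of
functions of (possibly polynomial) growth controlled by the weight `(1+|x|²)^{−δ/2}` with
`δ ∈ ℝ` arbitrary.  If `u` is continuous on `ℝⁿ × [0,T]`, its spatial second derivatives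
exist and are continuous on `ℝⁿ × (0,T)`, `u` solves `∂_t u = μΔu` there (the `HasDerivAt`
hypothesis encodes both the existence of `∂_t u` and the equation), `u(·,0) = 0` and
`|u(x,t)| ≤ M(1+|x|²)^{−δ/2}`, then `u ≡ 0` on `ℝⁿ × [0,T]`. -/
theorem statement16 (n : ℕ) (hn : 2 ≤ n) (μ T δ : ℝ) (hμ : 0 < μ) (hT : 0 < T)
    (u : EuclideanSpace ℝ (Fin n) → ℝ → ℝ) (M : ℝ)
    (hcont : ContinuousOn (fun z : EuclideanSpace ℝ (Fin n) × ℝ => u z.1 z.2)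
      (Set.univ ×ˢ Set.Icc (0 : ℝ) T))
    (hdiff1 : ∀ (x : EuclideanSpace ℝ (Fin n)) (t : ℝ), 0 < t → t < T →
      DifferentiableAt ℝ (fun y => u y t) x)
    (hdiff2 : ∀ (i : Fin n) (x : EuclideanSpace ℝ (Fin n)) (t : ℝ), 0 < t → t < T →
      DifferentiableAt ℝ (fun y => pdx i u y t) x)
    (hcont2 : ∀ i j : Fin n,
      ContinuousOn (fun z : EuclideanSpace ℝ (Fin n) × ℝ => pdx j (pdx i u) z.1 z.2)
        (Set.univ ×ˢ Set.Ioo (0 : ℝ) T))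
    (hheat : ∀ (x : EuclideanSpace ℝ (Fin n)) (t : ℝ), 0 < t → t < T →
      HasDerivAt (u x) (μ * ∑ i, pdx i (pdx i u) x t) t)
    (hinit : ∀ x, u x 0 = 0)
    (hbound : ∀ (x : EuclideanSpace ℝ (Fin n)) (t : ℝ), t ∈ Set.Icc (0 : ℝ) T →
      |u x t| ≤ M * (1 + ‖x‖ ^ 2) ^ (-δ / 2)) :
    ∀ (x : EuclideanSpace ℝ (Fin n)) (t : ℝ), t ∈ Set.Icc (0 : ℝ) T → u x t = 0 := by
  have hM : 0 ≤ M := by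
    have h := hbound 0 0 ⟨le_rfl, hT.le⟩
    simp only [norm_zero] at h
    norm_num at h
    exact (abs_nonneg _).trans h
  obtain ⟨k, hk⟩ := exists_nat_ge (-δ / 2)
  have hpoly : ∀ (x : EuclideanSpace ℝ (Fin n)) (t : ℝ), t ∈ Set.Icc (0 : ℝ) T →
      |u x t| ≤ M * (1 + ‖x‖ ^ 2) ^ k := by
    intro x t ht
    refine (hbound x t ht).trans ?_
    rw [← Real.rpow_natCast _ k]
    exact mul_le_mul_of_nonneg_left
      (Real.rpow_le_rpow_of_exponent_le (by linarith [sq_nonneg ‖x‖]) hk) hM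
  have hD₁ : ∀ i x t, 0 < t → t < T → ∀ s : ℝ,
      HasDerivAt (fun s => u (x + s • EuclideanSpace.single i (1 : ℝ)) t)
        (pdx i u (x + s • EuclideanSpace.single i (1 : ℝ)) t) s :=
    fun i x t h0 hT' s => hasDerivAt_comp_add_smul_single (hdiff1 _ t h0 hT')
  have hD₂ : ∀ i x t, 0 < t → t < T →
      HasDerivAt (fun s : ℝ => pdx i u (x + s • EuclideanSpace.single i (1 : ℝ)) t)
        (pdx i (pdx i u) x t) 0 := by
    intro i x t h0 hT'
    simpa using hasDerivAt_comp_add_smul_single (s := 0) (x := x) (hdiff2 i _ t h0 hT')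
  have hzero : ∀ x, ∀ t ∈ Ico (0 : ℝ) T, u x t = 0 := by
    intro x t ht
    refine le_antisymm ?_ ?_
    · exact heat_le_zero_of_poly_growth hμ hM k hcont hD₁ hD₂ hheat (fun x => (hinit x).le)
        (fun x t ht => (le_abs_self _).trans (hpoly x t ht)) x ht
    · have h := heat_le_zero_of_poly_growth (u := fun x t => -u x t)
        (D₁ := fun i x t => -pdx i u x t) (D₂ := fun i x t => -pdx i (pdx i u) x t) hμ hM k
        hcont.neg (fun i x t h0 hT' s => (hD₁ i x t h0 hT' s).neg)
        (fun i x t h0 hT' => (hD₂ i x t h0 hT').neg)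
        (fun x t h0 hT' => (hheat x t h0 hT').neg.congr_deriv (by simp))
        (fun x => by simp [hinit x])
        (fun x t ht => (neg_le_abs _).trans (hpoly x t ht)) x ht
      linarith
  intro x t ht
  have hslice : ContinuousOn (u x) (Icc 0 T) :=
    hcont.comp (f := fun t : ℝ => (x, t)) (by fun_prop) fun t ht => ⟨mem_univ _, ht⟩
  have heq : EqOn (u x) (fun _ => 0) (Icc 0 T) :=
    EqOn.of_subset_closure (hzero x) hslice continuousOn_const Ico_subset_Icc_self
      (closure_Ico hT.ne).ge
  exact heq ht
end
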